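/- arXiv:1504.02429 — 2 statements merged into one kernel-verified Lean document; each statement's English description precedes it below -/
import Mathlib

section
/- For every ε > 0, the probability that Σ_{z∈F} w(z)·1{w(z) < w_min} > ε is o(1/N²) as n → ∞, where the sum runs over all half-edges of the forest F produced by the exposure process and w_min := N^{−2/3}. -/
open Classical Filter Finset

noncomputable section

/-- The set of half-edges: `deg v` half-edges attached to each vertex `v`. -/
abbrev HE (k : ℕ) (dg : Fin k → ℕ) : Type := (v : Fin k) × Fin (dg v)

/-- A pairing is a fixed-point-free involution of the half-edges. -/
def IsPairing {k : ℕ} {dg : Fin k → ℕ} (π : Equiv.Perm (HE k dg)) : Prop :=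
  (∀ x, π (π x) = x) ∧ ∀ x, π x ≠ x

/-- `N`, the total number of half-edges. -/
def Nh {k : ℕ} (dg : Fin k → ℕ) : ℕ := ∑ v, dg v

/-- The non-backtracking random walk transition matrix: from `x`, move to a uniformly
chosen neighbour of `π x` (a half-edge at the same vertex as `π x`, distinct from it). -/
def nbrwP {k : ℕ} (dg : Fin k → ℕ) (π : Equiv.Perm (HE k dg)) :
    Matrix (HE k dg) (HE k dg) ℝ := fun x y =>
  if (π x).1 = y.1 ∧ π x ≠ y then ((dg (π x).1 : ℝ) - 1)⁻¹ else 0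

/-- Total-variation distance to the uniform distribution at time `t`, from state `x`. -/
def Dx {k : ℕ} (dg : Fin k → ℕ) (π : Equiv.Perm (HE k dg)) (x : HE k dg) (t : ℕ) : ℝ :=
  (1 / 2) * ∑ y, |((nbrwP dg π) ^ t) x y - (Nh dg : ℝ)⁻¹|

/-- Worst-case total-variation distance to equilibrium at time `t`. -/
def Dmax {k : ℕ} (dg : Fin k → ℕ) (π : Equiv.Perm (HE k dg)) (t : ℕ) : ℝ :=
  ⨆ x, Dx dg π x t

/-- Mixing time. -/
def tmixT {k : ℕ} (dg : Fin k → ℕ) (π : Equiv.Perm (HE k dg)) (ε : ℝ) : ℕ :=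
  sInf {t : ℕ | Dmax dg π t < ε}

/-- The finite set of all pairings of the half-edges. -/
def PairingsF {k : ℕ} (dg : Fin k → ℕ) : Finset (Equiv.Perm (HE k dg)) :=
  univ.filter IsPairing

/-- Probability of an event under the uniformly random pairing. -/
def prP {k : ℕ} (dg : Fin k → ℕ) (Q : Equiv.Perm (HE k dg) → Prop) : ℝ :=
  (((PairingsF dg).filter Q).card : ℝ) / ((PairingsF dg).card : ℝ)

/-- Mean logarithmic degree `μ` of a uniform half-edge. -/
def muD {k : ℕ} (dg : Fin k → ℕ) : ℝ :=
  (Nh dg : ℝ)⁻¹ * ∑ v, (dg v : ℝ) * Real.log ((dg v : ℝ) - 1)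

/-- Variance `σ²` of the logarithmic degree of a uniform half-edge. -/
def sigsq {k : ℕ} (dg : Fin k → ℕ) : ℝ :=
  (Nh dg : ℝ)⁻¹ * ∑ v, (dg v : ℝ) * (Real.log ((dg v : ℝ) - 1) - muD dg) ^ 2

/-- Third absolute central moment `ϱ`. -/
def rhoD {k : ℕ} (dg : Fin k → ℕ) : ℝ :=
  (Nh dg : ℝ)⁻¹ * ∑ v, (dg v : ℝ) * |Real.log ((dg v : ℝ) - 1) - muD dg| ^ 3

/-- Maximum degree `Δ`. -/
def DeltaD {k : ℕ} (dg : Fin k → ℕ) : ℕ := univ.sup dg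

/-- The standard normal tail function `Φ`. -/
def Phi (lam : ℝ) : ℝ :=
  (Real.sqrt (2 * Real.pi))⁻¹ * ∫ u in Set.Ioi lam, Real.exp (-u ^ 2 / 2)

/-- Cutoff time `t⋆ = log N / μ`. -/
def tstar {k : ℕ} (dg : Fin k → ℕ) : ℝ := Real.log (Nh dg) / muD dg

/-- Cutoff window `ω⋆ = √(σ² log N / μ³)`. -/
def wstar {k : ℕ} (dg : Fin k → ℕ) : ℝ :=
  Real.sqrt (sigsq dg * Real.log (Nh dg) / (muD dg) ^ 3)

/-- State of the exposure (exploration) process: the forest `F` (with height, weight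
and root data for each of its half-edges) and the set of already-paired half-edges. -/
structure ExpState (k : ℕ) (dg : Fin k → ℕ) where
  F : Finset (HE k dg)
  paired : Finset (HE k dg)
  ht : HE k dg → ℕ
  wt : HE k dg → ℝ
  rt : HE k dg → HE k dg

/-- Lexicographic encoding of half-edges (vertex index first, then half-edge index),
used for tie-breaking. -/
def enc {k : ℕ} (dg : Fin k → ℕ) (z : HE k dg) : ℕ := z.1.val * (Nh dg + 1) + z.2.val

/-- Candidate half-edges for selection: unpaired members of the forest with height
`< tH` and weight `> wmin`. -/
def cands {k : ℕ} {dg : Fin k → ℕ} (tH : ℕ) (wmin : ℝ) (s : ExpState k dg) :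
    Finset (HE k dg) :=
  s.F.filter fun z => z ∉ s.paired ∧ s.ht z < tH ∧ wmin < s.wt z

/-- `z` is the selected half-edge: a candidate of maximal weight, ties broken by the
lexicographic order on half-edges. -/
def IsSelected {k : ℕ} {dg : Fin k → ℕ} (tH : ℕ) (wmin : ℝ) (s : ExpState k dg)
    (z : HE k dg) : Prop :=
  z ∈ cands tH wmin s ∧ (∀ y ∈ cands tH wmin s, s.wt y ≤ s.wt z) ∧
    ∀ y ∈ cands tH wmin s, s.wt y = s.wt z → enc dg z ≤ enc dg y

/-- One step of the exploration stage: select `z`, reveal its partner `z' = π z`, and,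
if neither `z'` nor any of its neighbours was already in the forest, attach all
neighbours of `z'` as children of `z`. -/
def expStep {k : ℕ} {dg : Fin k → ℕ} (π : Equiv.Perm (HE k dg)) (tH : ℕ) (wmin : ℝ)
    (s : ExpState k dg) : ExpState k dg :=
  if hz : ∃ z, IsSelected tH wmin s z then
    let z := Classical.choose hz
    let z' := π z
    if ∀ y ∈ s.F, y.1 ≠ z'.1 then
      { F := s.F ∪ univ.filter (fun w => w.1 = z'.1 ∧ w ≠ z'),
        paired := insert z (insert z' s.paired),
        ht := fun w => if w.1 = z'.1 ∧ w ≠ z' then s.ht z + 1 else s.ht w,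
        wt := fun w => if w.1 = z'.1 ∧ w ≠ z' then s.wt z * ((dg z'.1 : ℝ) - 1)⁻¹ else s.wt w,
        rt := fun w => if w.1 = z'.1 ∧ w ≠ z' then s.rt z else s.rt w }
    else { s with paired := insert z (insert z' s.paired) }
  else s

/-- Initial state of the exposure process: forest reduced to the two roots `x`, `y`. -/
def expInit {k : ℕ} (dg : Fin k → ℕ) (x y : HE k dg) : ExpState k dg :=
  { F := {x, y}, paired := ∅, ht := fun _ => 0, wt := fun _ => 1,
    rt := fun z => if z = y then y else x }

/-- Final state of the exploration stage (the step map is iterated until it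
stabilizes, which happens within `N` iterations). -/
def expFinal {k : ℕ} (dg : Fin k → ℕ) (π : Equiv.Perm (HE k dg)) (tH : ℕ) (wmin : ℝ)
    (x y : HE k dg) : ExpState k dg :=
  (expStep π tH wmin)^[Nh dg] (expInit dg x y)

/-- `H_r`: unpaired half-edges of the forest with height `tH` and root `r`. -/
def Hset {k : ℕ} {dg : Fin k → ℕ} (s : ExpState k dg) (tH : ℕ) (r : HE k dg) :
    Finset (HE k dg) :=
  s.F.filter fun z => z ∉ s.paired ∧ s.ht z = tH ∧ s.rt z = r

/-- `U`: the set of unpaired half-edges of the forest. -/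
def Uset {k : ℕ} {dg : Fin k → ℕ} (s : ExpState k dg) : Finset (HE k dg) :=
  s.F.filter fun z => z ∉ s.paired

/-- `𝔚`: the small-weight part of the pair-weight sum. -/
def Wle {k : ℕ} {dg : Fin k → ℕ} (s : ExpState k dg) (tH : ℕ) (x y : HE k dg)
    (θ : ℝ) : ℝ :=
  ∑ u ∈ Hset s tH x, ∑ v ∈ Hset s tH y,
    if s.wt u * s.wt v ≤ θ then s.wt u * s.wt v else 0

/-- `𝔚̄`: the large-weight part of the pair-weight sum. -/
def Wgt {k : ℕ} {dg : Fin k → ℕ} (s : ExpState k dg) (tH : ℕ) (x y : HE k dg)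
    (θ : ℝ) : ℝ :=
  ∑ u ∈ Hset s tH x, ∑ v ∈ Hset s tH y,
    if θ < s.wt u * s.wt v then s.wt u * s.wt v else 0

/-- The truncation threshold `w_min = N^{-2/3}`. -/
def wminD {k : ℕ} (dg : Fin k → ℕ) : ℝ := (Nh dg : ℝ) ^ (-(2 : ℝ) / 3)

/-- The weight threshold `θ = 1/(N (log N)²)`. -/
def thetaD {k : ℕ} (dg : Fin k → ℕ) : ℝ :=
  ((Nh dg : ℝ) * (Real.log (Nh dg)) ^ 2)⁻¹

/-- The state obtained from `s` by pairing `z` with `u`. -/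
def revealPair {k : ℕ} {dg : Fin k → ℕ} (s : ExpState k dg) (z u : HE k dg) :
    ExpState k dg :=
  if ∀ y ∈ s.F, y.1 ≠ u.1 then
    { F := s.F ∪ univ.filter (fun w => w.1 = u.1 ∧ w ≠ u),
      paired := insert z (insert u s.paired),
      ht := fun w => if w.1 = u.1 ∧ w ≠ u then s.ht z + 1 else s.ht w,
      wt := fun w => if w.1 = u.1 ∧ w ≠ u then s.wt z * ((dg u.1 : ℝ) - 1)⁻¹ else s.wt w,
      rt := fun w => if w.1 = u.1 ∧ w ≠ u then s.rt z else s.rt w }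
  else { s with paired := insert z (insert u s.paired) }

lemma expStep_of_selected {k : ℕ} {dg : Fin k → ℕ} (π : Equiv.Perm (HE k dg)) (tH : ℕ)
    (wmin : ℝ) (s : ExpState k dg) (hz : ∃ z, IsSelected tH wmin s z) :
    expStep π tH wmin s = revealPair s (Classical.choose hz) (π (Classical.choose hz)) := by
  unfold expStep revealPair
  rw [dif_pos hz]

lemma expStep_of_not_selected {k : ℕ} {dg : Fin k → ℕ} (π : Equiv.Perm (HE k dg)) (tH : ℕ)
    (wmin : ℝ) (s : ExpState k dg) (hz : ¬ ∃ z, IsSelected tH wmin s z) :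
    expStep π tH wmin s = s := by
  unfold expStep
  rw [dif_neg hz]

lemma revealPair_paired {k : ℕ} {dg : Fin k → ℕ} (s : ExpState k dg) (z u : HE k dg) :
    (revealPair s z u).paired = insert z (insert u s.paired) := by
  unfold revealPair
  split_ifs <;> rfl

lemma revealPair_wt_nonneg {k : ℕ} {dg : Fin k → ℕ} (s : ExpState k dg) (z u : HE k dg)
    (hd : 1 ≤ dg u.1) (hs : ∀ y, 0 ≤ s.wt y) (y : HE k dg) :
    0 ≤ (revealPair s z u).wt y := by
  have hd' : (1 : ℝ) ≤ dg u.1 := by exact_mod_cast hd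
  unfold revealPair
  split_ifs with h
  · dsimp only
    split_ifs
    · exact mul_nonneg (hs z) (inv_nonneg.2 (by linarith))
    · exact hs y
  · exact hs y

/-- Total potential of a state: each half-edge of the forest which is unpaired or has small
weight contributes a function `G` of its height and weight. -/
def potential {k : ℕ} {dg : Fin k → ℕ} (wmin : ℝ) (G : ℕ → ℝ → ℝ) (s : ExpState k dg) : ℝ :=
  ∑ z ∈ s.F, if s.wt z < wmin ∨ z ∉ s.paired then G (s.ht z) (s.wt z) else 0

lemma card_siblings {k : ℕ} {dg : Fin k → ℕ} (u : HE k dg) :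
    ((univ.filter (fun w : HE k dg => w.1 = u.1 ∧ w ≠ u)).card : ℝ) = (dg u.1 : ℝ) - 1 := by
  have h : univ.filter (fun w : HE k dg => w.1 = u.1 ∧ w ≠ u)
      = (univ.erase u.2).map (Function.Embedding.sigmaMk u.1) := by
    ext ⟨v, i⟩
    obtain ⟨v', j⟩ := u
    simp only [mem_filter, mem_univ, true_and, Finset.mem_map, mem_erase, and_true,
      Function.Embedding.sigmaMk_apply]
    constructor
    · rintro ⟨rfl, h⟩
      exact ⟨i, fun e => h (by rw [e]), rfl⟩
    · rintro ⟨a, ha, he⟩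
      cases he
      exact ⟨rfl, fun e => ha (by simpa using e)⟩
  rw [h, card_map, card_erase_of_mem (mem_univ _), card_univ, Fintype.card_fin]
  have := u.2.isLt
  rw [Nat.cast_sub (by omega)]
  simp

lemma potential_revealPair_le {k : ℕ} {dg : Fin k → ℕ} {wmin : ℝ} {G : ℕ → ℝ → ℝ}
    (hG : ∀ h w, 0 ≤ w → 0 ≤ G h w) (s : ExpState k dg) (hs : ∀ y, 0 ≤ s.wt y)
    (z u : HE k dg) (hz : z ∈ s.F) (hzp : z ∉ s.paired) (hw : wmin < s.wt z)
    (hd : 1 ≤ dg u.1) :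
    potential wmin G (revealPair s z u) ≤ potential wmin G s - G (s.ht z) (s.wt z)
      + ((dg u.1 : ℝ) - 1) * G (s.ht z + 1) (s.wt z * ((dg u.1 : ℝ) - 1)⁻¹) := by
  have hd' : (0 : ℝ) ≤ (dg u.1 : ℝ) - 1 := by
    have : (1 : ℝ) ≤ dg u.1 := by exact_mod_cast hd
    linarith
  have hold : (∑ y ∈ s.F, if s.wt y < wmin ∨ y ∉ insert z (insert u s.paired)
      then G (s.ht y) (s.wt y) else 0) ≤ potential wmin G s - G (s.ht z) (s.wt z) := by
    unfold potential
    rw [← sum_erase_add _ _ hz, ← sum_erase_add (a := z) s.F _ hz]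
    rw [if_neg (by simp [hw.le]), if_pos (Or.inr hzp)]
    have : ∀ y ∈ s.F.erase z, (if s.wt y < wmin ∨ y ∉ insert z (insert u s.paired)
      then G (s.ht y) (s.wt y) else 0) ≤
        if s.wt y < wmin ∨ y ∉ s.paired then G (s.ht y) (s.wt y) else 0 := by
      intro y _
      have h0 := hG (s.ht y) (s.wt y) (hs y)
      by_cases h1 : s.wt y < wmin ∨ y ∉ s.paired
      · rw [if_pos h1]; split_ifs <;> simp [h0]
      · rw [if_neg h1, if_neg]
        push Not at h1 ⊢
        exact ⟨h1.1, by simp [h1.2]⟩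
    have := sum_le_sum this
    linarith
  have hnew : 0 ≤ G (s.ht z + 1) (s.wt z * ((dg u.1 : ℝ) - 1)⁻¹) :=
    hG _ _ (mul_nonneg (hs z) (inv_nonneg.2 hd'))
  by_cases h : ∀ y ∈ s.F, y.1 ≠ u.1
  · unfold potential at hold ⊢
    unfold revealPair
    rw [if_pos h]
    dsimp only
    rw [sum_union]
    · refine add_le_add ?_ ?_
      · refine le_trans (le_of_eq ?_) hold
        refine sum_congr rfl fun y hy => ?_
        simp only [h y hy, false_and, if_false]
      · refine (sum_le_card_nsmul _ _ (G (s.ht z + 1) (s.wt z * ((dg u.1 : ℝ) - 1)⁻¹))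
          fun y hy => ?_).trans_eq (by rw [nsmul_eq_mul, card_siblings])
        simp only [mem_filter, mem_univ, true_and] at hy
        simp only [if_pos hy]
        split_ifs
        · exact le_rfl
        · exact hnew
    · rw [disjoint_left]
      intro y hy hy'
      exact h y hy (mem_filter.1 hy').2.1
  · have : revealPair s z u = { s with paired := insert z (insert u s.paired) } := by
      unfold revealPair; rw [if_neg h]
    rw [this]
    have := mul_nonneg hd' hnew
    refine hold.trans (by linarith)

/-- Pairings which agree with `π₀` on `D`. -/
def agreeing {k : ℕ} (dg : Fin k → ℕ) (π₀ : Equiv.Perm (HE k dg)) (D : Finset (HE k dg)) :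
    Finset (Equiv.Perm (HE k dg)) :=
  (PairingsF dg).filter fun π => ∀ x ∈ D, π x = π₀ x

lemma card_agreeing_le {k : ℕ} {dg : Fin k → ℕ} {π₀ : Equiv.Perm (HE k dg)}
    {D : Finset (HE k dg)} (hD : ∀ x ∈ D, π₀ x ∈ D) {z u u' : HE k dg}
    (hu : u ∉ D) (hu' : u' ∉ D) (huz : u ≠ z) (huz' : u' ≠ z) :
    ((agreeing dg π₀ D).filter fun π => π z = u).card
      ≤ ((agreeing dg π₀ D).filter fun π => π z = u').card := by
  refine card_le_card_of_injOn (fun π => Equiv.swap u u' * π * Equiv.swap u u') ?_ ?_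
  · intro π hπ
    simp only [agreeing, PairingsF, IsPairing, coe_filter, mem_filter, mem_univ, true_and,
      Set.mem_ofPred_eq] at hπ ⊢
    obtain ⟨⟨⟨h1, h2⟩, h3⟩, h4⟩ := hπ
    have hfix : ∀ x ∈ D, Equiv.swap u u' x = x := fun x hx =>
      Equiv.swap_apply_of_ne_of_ne (fun e => hu (e ▸ hx)) (fun e => hu' (e ▸ hx))
    refine ⟨⟨⟨fun x => by simp [h1], fun x hx => ?_⟩, fun x hx => ?_⟩, ?_⟩
    · apply h2 (Equiv.swap u u' x)
      apply (Equiv.swap u u').injective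
      simpa using hx
    · simp [hfix x hx, h3 x hx, hfix _ (hD x hx)]
    · simp [Equiv.swap_apply_of_ne_of_ne huz.symm huz'.symm, h4]
  · intro π _ π' _ h
    simpa using h

lemma sum_agreeing_le {k : ℕ} {dg : Fin k → ℕ} {tH : ℕ} {wmin : ℝ}
    (V : ExpState k dg → ℝ) (I : ExpState k dg → Prop)
    (hI : ∀ s z u, I s → z ∈ cands tH wmin s → I (revealPair s z u))
    (hV : ∀ s z, I s → z ∈ cands tH wmin s →
      ∑ u ∈ (insert z s.paired)ᶜ, V (revealPair s z u) ≤ ((insert z s.paired)ᶜ.card : ℝ) * V s)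
    (j : ℕ) (s : ExpState k dg) (hs : I s) (π₀ : Equiv.Perm (HE k dg))
    (hD : ∀ x ∈ s.paired, π₀ x ∈ s.paired) :
    ∑ π ∈ agreeing dg π₀ s.paired, V ((expStep π tH wmin)^[j] s)
      ≤ (agreeing dg π₀ s.paired).card * V s := by
  induction j generalizing s π₀ with
  | zero => simp
  | succ j ih =>
    simp only [Function.iterate_succ_apply]
    by_cases hz : ∃ z, IsSelected tH wmin s z
    · set z := Classical.choose hz
      have hzc : z ∈ cands tH wmin s := (Classical.choose_spec hz).1
      have hzp : z ∉ s.paired := (mem_filter.1 hzc).2.1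
      set S := (insert z s.paired)ᶜ with hS
      set A := agreeing dg π₀ s.paired with hA
      have hstep : ∀ π, expStep π tH wmin s = revealPair s z (π z) := fun π =>
        expStep_of_selected π tH wmin s hz
      have hmaps : ∀ π ∈ A, π z ∈ S := by
        intro π hπ
        simp only [hA, agreeing, PairingsF, IsPairing, mem_filter, mem_univ, true_and] at hπ
        simp only [hS, mem_compl, mem_insert, not_or]
        refine ⟨hπ.1.2 z, fun h => hzp ?_⟩
        have := hD _ h
        rwa [← hπ.2 _ h, hπ.1.1] at this
      simp only [hstep]
      rw [← sum_fiberwise_of_maps_to hmaps]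
      obtain ⟨c, hc⟩ : ∃ c : ℕ, ∀ u ∈ S, (A.filter fun π => π z = u).card = c := by
        by_cases hne : S.Nonempty
        · obtain ⟨u₀, hu₀⟩ := hne
          refine ⟨(A.filter fun π => π z = u₀).card, fun u hu => ?_⟩
          simp only [hS, mem_compl, mem_insert, not_or] at hu hu₀
          exact le_antisymm (card_agreeing_le hD hu.2 hu₀.2 hu.1 hu₀.1)
            (card_agreeing_le hD hu₀.2 hu.2 hu₀.1 hu.1)
        · exact ⟨0, fun u hu => absurd ⟨u, hu⟩ hne⟩
      have hcard : (A.card : ℝ) = S.card * c := by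
        rw [card_eq_sum_card_fiberwise hmaps, sum_congr rfl hc]
        simp
      have hclass : ∀ u ∈ S, ∑ π ∈ A.filter (fun π => π z = u),
          V ((expStep π tH wmin)^[j] (revealPair s z (π z))) ≤ c * V (revealPair s z u) := by
        intro u hu
        rw [← hc u hu]
        by_cases hne : (A.filter fun π => π z = u).Nonempty
        · obtain ⟨π₁, hπ₁⟩ := hne
          have hπ₁' := hπ₁
          simp only [hA, agreeing, PairingsF, IsPairing, mem_filter, mem_univ, true_and]
            at hπ₁'
          obtain ⟨⟨⟨h1, h2⟩, h3⟩, h4⟩ := hπ₁'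
          have hu1 : π₁ u = z := by rw [← h4, h1]
          have hcl : (A.filter fun π => π z = u)
              = agreeing dg π₁ (revealPair s z u).paired := by
            ext π
            simp only [hA, agreeing, mem_filter, revealPair_paired, mem_insert,
              forall_eq_or_imp, h4, hu1, and_assoc]
            refine and_congr_right fun hp => ?_
            simp only [PairingsF, IsPairing, mem_filter, mem_univ, true_and] at hp
            constructor
            · rintro ⟨ha, hb⟩
              exact ⟨hb, by rw [← hb, hp.1], fun x hx => by rw [ha x hx, h3 x hx]⟩
            · rintro ⟨ha, -, hb⟩
              exact ⟨fun x hx => by rw [hb x hx, h3 x hx], ha⟩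
          have hih := ih (revealPair s z u) (hI s z u hs hzc) π₁ (by
            intro x hx
            simp only [revealPair_paired, mem_insert] at hx ⊢
            rcases hx with rfl | rfl | hx
            · simp [h4]
            · simp [hu1]
            · rw [h3 x hx]
              exact Or.inr (Or.inr (hD x hx)))
          rw [← hcl] at hih
          refine le_trans (le_of_eq (sum_congr rfl fun π hπ => ?_)) hih
          rw [(mem_filter.1 hπ).2]
        · rw [not_nonempty_iff_eq_empty] at hne
          simp [hne]
      calc _ ≤ ∑ u ∈ S, c * V (revealPair s z u) := sum_le_sum hclass
        _ = c * ∑ u ∈ S, V (revealPair s z u) := by rw [mul_sum]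
        _ ≤ c * (S.card * V s) := mul_le_mul_of_nonneg_left (hV s z hs hzc) (by positivity)
        _ = _ := by rw [hcard]; ring
    · simp only [expStep_of_not_selected _ tH wmin s hz]
      exact ih s hs π₀ hD

/-- States with nonnegative weights whose number of paired half-edges is controlled by the
remaining weighted height. -/
def WithinBudget {k : ℕ} {dg : Fin k → ℕ} (tH : ℕ) (wmin : ℝ) (s : ExpState k dg) : Prop :=
  (∀ y, 0 ≤ s.wt y) ∧
    potential wmin (fun h w => w * ((tH - h : ℕ) : ℝ)) s + wmin * s.paired.card / 2 ≤ 2 * tH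

lemma withinBudget_revealPair {k : ℕ} {dg : Fin k → ℕ} {tH : ℕ} {wmin : ℝ} (hw : 0 < wmin)
    (hmin : ∀ v, 3 ≤ dg v) {s : ExpState k dg} (hs : WithinBudget tH wmin s)
    {z : HE k dg} (hz : z ∈ cands tH wmin s) (u : HE k dg) :
    WithinBudget tH wmin (revealPair s z u) := by
  obtain ⟨h0, hb⟩ := hs
  obtain ⟨hzF, hzp, hzh, hzw⟩ := mem_filter.1 hz
  have hd : 1 ≤ dg u.1 := by linarith [hmin u.1]
  have hd' : (0 : ℝ) < (dg u.1 : ℝ) - 1 := by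
    have : (3 : ℝ) ≤ dg u.1 := by exact_mod_cast hmin u.1
    linarith
  refine ⟨revealPair_wt_nonneg s z u hd h0, ?_⟩
  have h1 := potential_revealPair_le (wmin := wmin) (G := fun h w => w * ((tH - h : ℕ) : ℝ))
    (fun h w hw => by positivity) s h0 z u hzF hzp hzw hd
  have h2 : ((revealPair s z u).paired.card : ℝ) ≤ s.paired.card + 2 := by
    rw [revealPair_paired]
    have := card_insert_le z (insert u s.paired)
    have := card_insert_le u s.paired
    norm_cast
    omega
  have h3 : ((tH - s.ht z : ℕ) : ℝ) = ((tH - (s.ht z + 1) : ℕ) : ℝ) + 1 := by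
    norm_cast; omega
  have h4 : ((dg u.1 : ℝ) - 1) * (s.wt z * ((dg u.1 : ℝ) - 1)⁻¹ *
      ((tH - (s.ht z + 1) : ℕ) : ℝ)) = s.wt z * ((tH - (s.ht z + 1) : ℕ) : ℝ) := by
    field_simp
  simp only [h3, h4] at h1
  nlinarith

lemma card_halfEdges {k : ℕ} (dg : Fin k → ℕ) : Fintype.card (HE k dg) = Nh dg := by
  simp [Nh]

lemma sum_exp_potential_expFinal_le {k : ℕ} {dg : Fin k → ℕ} {tH : ℕ} {wmin κ : ℝ}
    (hw : 0 < wmin) (hκ : 0 ≤ κ) (hmin : ∀ v, 3 ≤ dg v) {G : ℕ → ℝ → ℝ}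
    (hG : ∀ h w, 0 ≤ w → 0 ≤ G h w)
    (hN : (Nh dg : ℝ) ≤ (1 + κ) * (Nh dg - 4 * tH / wmin - 1))
    (hstep : ∀ h w, h < tH → wmin < w → ∀ S : Finset (HE k dg),
      (Nh dg : ℝ) ≤ (1 + κ) * S.card →
      ∑ u ∈ S, Real.exp (((dg u.1 : ℝ) - 1) * G (h + 1) (w * ((dg u.1 : ℝ) - 1)⁻¹))
        ≤ S.card * Real.exp (G h w))
    (x y : HE k dg) :
    ∑ π ∈ PairingsF dg, Real.exp (potential wmin G (expFinal dg π tH wmin x y))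
      ≤ (PairingsF dg).card * Real.exp (2 * G 0 1) := by
  by_cases hne : (PairingsF dg).Nonempty
  swap
  · rw [not_nonempty_iff_eq_empty] at hne
    simp [hne]
  obtain ⟨π₀, -⟩ := hne
  have hinit : ∀ G : ℕ → ℝ → ℝ, 0 ≤ G 0 1 → potential wmin G (expInit dg x y) ≤ 2 * G 0 1 := by
    intro G hG1
    simp only [potential, expInit, notMem_empty, not_false_eq_true, or_true, if_true,
      sum_const, nsmul_eq_mul]
    have : (({x, y} : Finset (HE k dg)).card : ℝ) ≤ 2 := by exact_mod_cast card_le_two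
    exact mul_le_mul_of_nonneg_right this hG1
  have key := sum_agreeing_le (tH := tH) (wmin := wmin)
    (fun s => Real.exp (potential wmin G s)) (WithinBudget tH wmin)
    (fun s z u hs hz => withinBudget_revealPair hw hmin hs hz u) ?_ (Nh dg) (expInit dg x y)
    ⟨fun _ => zero_le_one, ?_⟩ π₀ (by simp [expInit])
  · have hA : agreeing dg π₀ (expInit dg x y).paired = PairingsF dg := by
      simp [agreeing, expInit]
    rw [hA] at key
    refine key.trans (mul_le_mul_of_nonneg_left (Real.exp_le_exp.2 ?_) (by positivity))
    exact hinit G (hG 0 1 zero_le_one)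
  · rintro s z ⟨h0, hb⟩ hz
    obtain ⟨hzF, hzp, hzh, hzw⟩ := mem_filter.1 hz
    set S := (insert z s.paired)ᶜ with hS
    have hpot : 0 ≤ potential wmin (fun h w => w * ((tH - h : ℕ) : ℝ)) s := by
      refine sum_nonneg fun y _ => ?_
      have := h0 y
      split_ifs
      · positivity
      · exact le_rfl
    have hp : (s.paired.card : ℝ) ≤ 4 * tH / wmin := by
      rw [le_div_iff₀ hw]
      linarith
    have hcard : (Nh dg : ℝ) - 4 * tH / wmin - 1 ≤ S.card := by
      rw [hS, card_compl, card_halfEdges, card_insert_of_notMem hzp, Nat.cast_sub]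
      · push_cast
        linarith
      · rw [← card_halfEdges, ← card_insert_of_notMem hzp]
        exact card_le_univ _
    have hb1 := hstep (s.ht z) (s.wt z) hzh hzw S
      (hN.trans (mul_le_mul_of_nonneg_left hcard (by linarith)))
    have hb2 : ∀ u ∈ S, Real.exp (potential wmin G (revealPair s z u)) ≤
        Real.exp (((dg u.1 : ℝ) - 1) * G (s.ht z + 1) (s.wt z * ((dg u.1 : ℝ) - 1)⁻¹)) *
          Real.exp (potential wmin G s - G (s.ht z) (s.wt z)) := by
      intro u _
      rw [← Real.exp_add, Real.exp_le_exp]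
      have := potential_revealPair_le hG s h0 z u hzF hzp hzw (by linarith [hmin u.1])
      linarith
    refine (sum_le_sum hb2).trans ?_
    rw [← sum_mul]
    refine (mul_le_mul_of_nonneg_right hb1 (Real.exp_pos _).le).trans_eq ?_
    rw [mul_assoc, ← Real.exp_add]
    ring_nf
  · have := hinit (fun h w => w * ((tH - h : ℕ) : ℝ)) (by simp)
    simp only [expInit, card_empty] at this ⊢
    simpa using this

/-- Potential of a half-edge at height `h` with weight `w`, in terms of an exponentially
tilted estimate of the chance that its weight becomes small before height `T`. -/
def tiltPot (l η wmin C p A : ℝ) (T h : ℕ) (w : ℝ) : ℝ :=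
  if η ≤ w then w * C
  else l * w * min 1 ((wmin / w) ^ p * A ^ (T - h)) + 4 * (l * w) ^ 2

lemma tiltPot_nonneg {l η wmin C p A : ℝ} (hl : 0 ≤ l) (hwm : 0 < wmin) (hC : 0 ≤ C)
    (hA : 1 ≤ A) (T h : ℕ) {w : ℝ} (hw : 0 ≤ w) : 0 ≤ tiltPot l η wmin C p A T h w := by
  unfold tiltPot
  split_ifs
  · positivity
  · positivity

lemma mul_tiltPot_le_of_le {l η wmin C p A δ Δ : ℝ} {T h : ℕ} (hl : 0 ≤ l) (hη : 0 < η)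
    (hwm : 0 < wmin) (hA : 1 ≤ A) (hp : 0 ≤ p) (hC : C = l * δ + 4 * l ^ 2 * η)
    (hδ : (wmin * Δ / η) ^ p * A ^ T ≤ δ) {w d : ℝ} (hw : η ≤ w) (hd : 2 ≤ d) (hdΔ : d ≤ Δ) :
    d * tiltPot l η wmin C p A T (h + 1) (w * d⁻¹) ≤ w * C := by
  have hd0 : 0 < d := by linarith
  have hΔ0 : 0 < Δ := by linarith
  have hw0 : 0 < w := by linarith
  unfold tiltPot
  split_ifs with h1
  · apply le_of_eq; field_simp
  · push Not at h1
    have hQ : min 1 ((wmin / (w * d⁻¹)) ^ p * A ^ (T - (h + 1))) ≤ δ := by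
      refine (min_le_right _ _).trans (le_trans ?_ hδ)
      refine mul_le_mul ?_ (pow_le_pow_right₀ hA (by omega)) (by positivity) (by positivity)
      refine Real.rpow_le_rpow (by positivity) ?_ hp
      have : wmin / (w * d⁻¹) = wmin * d / w := by field_simp
      rw [this]
      gcongr
    have e1 : d * (l * (w * d⁻¹) * min 1 ((wmin / (w * d⁻¹)) ^ p * A ^ (T - (h + 1)))
        + 4 * (l * (w * d⁻¹)) ^ 2) = l * w * min 1 ((wmin / (w * d⁻¹)) ^ p * A ^ (T - (h + 1)))
          + 4 * l ^ 2 * w * (w * d⁻¹) := by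
      field_simp
    rw [e1, hC]
    have e2 := mul_le_mul_of_nonneg_left hQ (mul_nonneg hl hw0.le)
    have e3 := mul_le_mul_of_nonneg_left h1.le (by positivity : 0 ≤ 4 * l ^ 2 * w)
    linarith

lemma exp_mul_tiltPot_le {l η wmin C p A : ℝ} {T h : ℕ} (hl : 0 ≤ l)
    (hwm : 0 < wmin) (hA : 1 ≤ A) (hlη : l * η ≤ 1 / 10)
    {w d : ℝ} (hw0 : 0 < w) (hw : w < η) (hd : 2 ≤ d) :
    Real.exp (d * tiltPot l η wmin C p A T (h + 1) (w * d⁻¹)) ≤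
      1 + l * w * min 1 ((wmin / (w * d⁻¹)) ^ p * A ^ (T - (h + 1))) + 4 * (l * w) ^ 2 := by
  have hd0 : 0 < d := by linarith
  have hwd : w * d⁻¹ ≤ w / 2 := by
    rw [← div_eq_mul_inv]
    gcongr
  have hlt : ¬ η ≤ w * d⁻¹ := by linarith
  unfold tiltPot
  rw [if_neg hlt]
  set Q := min 1 ((wmin / (w * d⁻¹)) ^ p * A ^ (T - (h + 1))) with hQ
  have hQ0 : 0 ≤ Q := by positivity
  have hQ1 : Q ≤ 1 := min_le_left _ _
  set m := l * w with hm
  have hm0 : 0 ≤ m := by positivity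
  have hm1 : m ≤ 1 / 10 := (mul_le_mul_of_nonneg_left hw.le hl).trans hlη
  have e1 : d * (l * (w * d⁻¹) * Q + 4 * (l * (w * d⁻¹)) ^ 2) = m * Q + 4 * m ^ 2 * d⁻¹ := by
    rw [hm]; field_simp
  rw [e1]
  have hdi : d⁻¹ ≤ 1 / 2 := by
    rw [inv_le_comm₀ hd0 (by norm_num)]; linarith
  have hdi0 : 0 ≤ d⁻¹ := by positivity
  have hY : m * Q + 4 * m ^ 2 * d⁻¹ ≤ m * Q + 2 * m ^ 2 := by nlinarith [sq_nonneg m]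
  set Y := m * Q + 2 * m ^ 2 with hYdef
  have hY0 : 0 ≤ Y := by positivity
  have hY1 : Y ≤ 1.2 * m := by nlinarith
  have := (abs_le.1 (Real.abs_exp_sub_one_sub_id_le (x := Y)
    (by rw [abs_of_nonneg hY0]; linarith))).2
  have h2 := Real.exp_le_exp.2 hY
  nlinarith

lemma sum_exp_tiltPot_le {k : ℕ} {dg : Fin k → ℕ} {l η wmin C p A δ Δ κ : ℝ} {T h : ℕ}
    (hl : 0 ≤ l) (hwη : wmin ≤ η) (hwm : 0 < wmin) (hA : 1 ≤ A) (hp : 0 ≤ p) (hκ : 0 ≤ κ)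
    (hC : C = l * δ + 4 * l ^ 2 * η) (hδ : (wmin * Δ / η) ^ p * A ^ T ≤ δ)
    (hlη : l * η ≤ 1 / 10) (hmin : ∀ v, 3 ≤ dg v) (hmax : ∀ v, (dg v : ℝ) ≤ Δ)
    (hAavg : (1 + κ) * ∑ u : HE k dg, ((dg u.1 : ℝ) - 1) ^ p ≤ A * Nh dg)
    (hh : h < T) {w : ℝ} (hw : wmin < w) (S : Finset (HE k dg))
    (hS : (Nh dg : ℝ) ≤ (1 + κ) * S.card) :
    ∑ u ∈ S, Real.exp (((dg u.1 : ℝ) - 1) *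
        tiltPot l η wmin C p A T (h + 1) (w * ((dg u.1 : ℝ) - 1)⁻¹))
      ≤ S.card * Real.exp (tiltPot l η wmin C p A T h w) := by
  have hw0 : 0 < w := hwm.trans hw
  have hd : ∀ u : HE k dg, (2 : ℝ) ≤ (dg u.1 : ℝ) - 1 := fun u => by
    have : (3 : ℝ) ≤ dg u.1 := by exact_mod_cast hmin u.1
    linarith
  by_cases hηw : η ≤ w
  · rw [← nsmul_eq_mul]
    refine sum_le_card_nsmul _ _ _ fun u _ => Real.exp_le_exp.2 ?_
    refine (mul_tiltPot_le_of_le hl (hwm.trans_le hwη) hwm hA hp hC hδ hηw (hd u)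
      (by linarith [hmax u.1])).trans_eq ?_
    rw [tiltPot, if_pos hηw]
  · push Not at hηw
    set Q : HE k dg → ℝ := fun u =>
      min 1 ((wmin / (w * ((dg u.1 : ℝ) - 1)⁻¹)) ^ p * A ^ (T - (h + 1))) with hQ
    set q := (wmin / w) ^ p * A ^ (T - h) with hq
    have h1 : ∑ u ∈ S, Q u ≤ S.card := by
      simpa using sum_le_card_nsmul S Q 1 fun u _ => min_le_left _ _
    have h2 : ∑ u ∈ S, Q u ≤ S.card * q := by
      have e : ∀ u, Q u ≤ (wmin / w) ^ p * A ^ (T - (h + 1)) * ((dg u.1 : ℝ) - 1) ^ p := by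
        intro u
        have := hd u
        refine (min_le_right _ _).trans_eq ?_
        have e' : wmin / (w * ((dg u.1 : ℝ) - 1)⁻¹) = wmin / w * ((dg u.1 : ℝ) - 1) := by
          field_simp
        rw [e', Real.mul_rpow (by positivity) (by linarith)]
        ring
      have e2 : ∑ u ∈ S, ((dg u.1 : ℝ) - 1) ^ p ≤ A * S.card := by
        have e3 : ∑ u ∈ S, ((dg u.1 : ℝ) - 1) ^ p ≤ ∑ u : HE k dg, ((dg u.1 : ℝ) - 1) ^ p :=
          sum_le_sum_of_subset_of_nonneg (subset_univ _) fun u _ _ =>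
            Real.rpow_nonneg (by linarith [hd u]) _
        have e4 : (1 + κ) * ∑ u : HE k dg, ((dg u.1 : ℝ) - 1) ^ p
            ≤ (1 + κ) * (A * S.card) := by
          refine hAavg.trans ?_
          have := mul_le_mul_of_nonneg_left hS (by linarith : 0 ≤ A)
          linarith
        exact e3.trans (le_of_mul_le_mul_left e4 (by linarith))
      have e5 : A ^ (T - h) = A ^ (T - (h + 1)) * A := by
        rw [← pow_succ]; congr 1; omega
      calc ∑ u ∈ S, Q u ≤ (wmin / w) ^ p * A ^ (T - (h + 1)) *
            ∑ u ∈ S, ((dg u.1 : ℝ) - 1) ^ p := by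
            rw [mul_sum]; exact sum_le_sum fun u _ => e u
        _ ≤ (wmin / w) ^ p * A ^ (T - (h + 1)) * (A * S.card) :=
            mul_le_mul_of_nonneg_left e2 (by positivity)
        _ = S.card * q := by rw [hq, e5]; ring
    have h3 : ∑ u ∈ S, Q u ≤ S.card * min 1 q := by
      rcases min_cases 1 q with ⟨e, -⟩ | ⟨e, -⟩ <;> rw [e]
      · simpa using h1
      · exact h2
    calc _ ≤ ∑ u ∈ S, (1 + l * w * Q u + 4 * (l * w) ^ 2) :=
          sum_le_sum fun u _ => exp_mul_tiltPot_le hl hwm hA hlη hw0 hηw (hd u)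
      _ = S.card + l * w * ∑ u ∈ S, Q u + S.card * (4 * (l * w) ^ 2) := by
          simp only [sum_add_distrib, ← mul_sum, sum_const, nsmul_eq_mul, mul_one]
          ring
      _ ≤ S.card + l * w * (S.card * min 1 q) + S.card * (4 * (l * w) ^ 2) := by gcongr
      _ = S.card * (tiltPot l η wmin C p A T h w + 1) := by
          rw [tiltPot, if_neg (not_le.2 hηw)]; ring
      _ ≤ _ := mul_le_mul_of_nonneg_left (Real.add_one_le_exp _) (by positivity)

lemma expStep_wt_nonneg {k : ℕ} {dg : Fin k → ℕ} (hmin : ∀ v, 3 ≤ dg v)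
    (π : Equiv.Perm (HE k dg)) (tH : ℕ) (wmin : ℝ) (s : ExpState k dg)
    (hs : ∀ y, 0 ≤ s.wt y) (y : HE k dg) : 0 ≤ (expStep π tH wmin s).wt y := by
  by_cases hz : ∃ z, IsSelected tH wmin s z
  · rw [expStep_of_selected π tH wmin s hz]
    exact revealPair_wt_nonneg _ _ _ (le_trans (by norm_num) (hmin _)) hs y
  · rw [expStep_of_not_selected π tH wmin s hz]
    exact hs y

lemma expFinal_wt_nonneg {k : ℕ} {dg : Fin k → ℕ} (hmin : ∀ v, 3 ≤ dg v)
    (π : Equiv.Perm (HE k dg)) (tH : ℕ) (wmin : ℝ) (x y z : HE k dg) :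
    0 ≤ (expFinal dg π tH wmin x y).wt z := by
  unfold expFinal
  refine Function.Iterate.rec (fun s : ExpState k dg => ∀ y, 0 ≤ s.wt y)
    (fun _ => zero_le_one) (fun s hs => expStep_wt_nonneg hmin π tH wmin s hs) (Nh dg) z

lemma prP_small_weights_le {k : ℕ} {dg : Fin k → ℕ} {l η wmin p A δ Δ κ ε : ℝ} {T : ℕ}
    (hl : 0 ≤ l) (hwη : wmin ≤ η) (hη1 : η ≤ 1) (hwm : 0 < wmin) (hA : 1 ≤ A) (hp : 0 ≤ p)
    (hκ : 0 ≤ κ) (hδ0 : 0 ≤ δ) (hδ : (wmin * Δ / η) ^ p * A ^ T ≤ δ)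
    (hlη : l * η ≤ 1 / 10) (hmin : ∀ v, 3 ≤ dg v) (hmax : ∀ v, (dg v : ℝ) ≤ Δ)
    (hAavg : (1 + κ) * ∑ u : HE k dg, ((dg u.1 : ℝ) - 1) ^ p ≤ A * Nh dg)
    (hN : (Nh dg : ℝ) ≤ (1 + κ) * (Nh dg - 4 * T / wmin - 1)) (x y : HE k dg) :
    prP dg (fun π => ε < ∑ z ∈ (expFinal dg π T wmin x y).F,
        if (expFinal dg π T wmin x y).wt z < wmin
        then (expFinal dg π T wmin x y).wt z else 0)
      ≤ Real.exp (2 * (l * δ + 4 * l ^ 2 * η) - l * ε) := by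
  set C := l * δ + 4 * l ^ 2 * η with hC
  have hη0 : 0 < η := hwm.trans_le hwη
  have hC0 : 0 ≤ C := by positivity
  have key := sum_exp_potential_expFinal_le (G := tiltPot l η wmin C p A T) hwm hκ hmin
    (fun h w hw => tiltPot_nonneg hl hwm hC0 hA T h hw) hN
    (fun h w hh hw S hS => sum_exp_tiltPot_le hl hwη hwm hA hp hκ hC hδ hlη hmin hmax hAavg hh
      hw S hS) x y
  have h01 : tiltPot l η wmin C p A T 0 1 = C := by simp [tiltPot, hη1]
  rw [h01] at key
  set st := fun π => expFinal dg π T wmin x y with hst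
  have hpot : ∀ π, l * (∑ z ∈ (st π).F, if (st π).wt z < wmin then (st π).wt z else 0)
      ≤ potential wmin (tiltPot l η wmin C p A T) (st π) := by
    intro π
    rw [mul_sum]
    refine sum_le_sum fun z _ => ?_
    have hw0 : 0 ≤ (st π).wt z := expFinal_wt_nonneg hmin π T wmin x y z
    by_cases hz : (st π).wt z < wmin
    · rw [if_pos hz, if_pos (Or.inl hz)]
      rcases hw0.eq_or_lt with h0 | h0
      · rw [← h0]
        simpa using tiltPot_nonneg hl hwm hC0 hA T _ le_rfl
      · rw [tiltPot, if_neg (by linarith), min_eq_left]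
        · nlinarith [sq_nonneg (l * (st π).wt z)]
        · exact one_le_mul_of_one_le_of_one_le
            (Real.one_le_rpow (by rw [one_le_div h0]; exact hz.le) hp) (one_le_pow₀ hA)
    · rw [if_neg hz, mul_zero]
      split_ifs
      · exact tiltPot_nonneg hl hwm hC0 hA T _ hw0
      · exact le_rfl
  unfold prP
  set Q := fun π => ε < ∑ z ∈ (st π).F, if (st π).wt z < wmin then (st π).wt z else 0 with hQ
  refine div_le_of_le_mul₀ (by positivity) (by positivity) ?_
  have hmarkov : (((PairingsF dg).filter Q).card : ℝ) * Real.exp (l * ε)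
      ≤ (PairingsF dg).card * Real.exp (2 * C) := by
    refine le_trans ?_ key
    refine le_trans ?_ (sum_le_sum_of_subset_of_nonneg (filter_subset Q _)
      fun _ _ _ => (Real.exp_pos _).le)
    rw [← nsmul_eq_mul]
    refine card_nsmul_le_sum _ _ _ fun π hπ => Real.exp_le_exp.2 ?_
    exact (mul_le_mul_of_nonneg_left (mem_filter.1 hπ).2.le hl).trans (hpot π)
  rw [Real.exp_sub, div_mul_eq_mul_div, le_div_iff₀ (Real.exp_pos _)]
  linarith

lemma sum_halfEdges {k : ℕ} (dg : Fin k → ℕ) (f : Fin k → ℝ) :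
    ∑ u : HE k dg, f u.1 = ∑ v, (dg v : ℝ) * f v := by
  rw [Fintype.sum_sigma]
  simp

lemma log_degree_bounds {k : ℕ} {dg : Fin k → ℕ} (hmin : ∀ v, 3 ≤ dg v) (v : Fin k) :
    1 / 2 ≤ Real.log ((dg v : ℝ) - 1) ∧
      Real.log ((dg v : ℝ) - 1) ≤ Real.log (DeltaD dg) ∧ (dg v : ℝ) ≤ DeltaD dg := by
  have h3 : (3 : ℝ) ≤ dg v := by exact_mod_cast hmin v
  have hΔ : (dg v : ℝ) ≤ DeltaD dg := by
    exact_mod_cast (le_sup (f := dg) (mem_univ v) : dg v ≤ univ.sup dg)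
  refine ⟨?_, Real.log_le_log (by linarith) (by linarith), hΔ⟩
  have := Real.log_le_log (by norm_num) (by linarith : (2 : ℝ) ≤ (dg v : ℝ) - 1)
  linarith [Real.log_two_gt_d9]

lemma half_le_muD {k : ℕ} {dg : Fin k → ℕ} (hmin : ∀ v, 3 ≤ dg v) (hN : 0 < Nh dg) :
    1 / 2 ≤ muD dg := by
  have hN' : (0 : ℝ) < Nh dg := by exact_mod_cast hN
  unfold muD
  rw [inv_mul_eq_div, le_div_iff₀ hN']
  have : (Nh dg : ℝ) = ∑ v, (dg v : ℝ) := by simp [Nh]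
  rw [this, mul_sum]
  refine sum_le_sum fun v _ => ?_
  rw [mul_comm]
  exact mul_le_mul_of_nonneg_left (log_degree_bounds hmin v).1 (by positivity)

lemma sigsq_nonneg {k : ℕ} (dg : Fin k → ℕ) : 0 ≤ sigsq dg := by
  unfold sigsq
  positivity

lemma sigsq_le {k : ℕ} {dg : Fin k → ℕ} (hmin : ∀ v, 3 ≤ dg v) (hN : 0 < Nh dg) :
    sigsq dg ≤ Real.log (DeltaD dg) * muD dg := by
  have hN' : (0 : ℝ) < Nh dg := by exact_mod_cast hN
  have hs : (Nh dg : ℝ) = ∑ v, (dg v : ℝ) := by simp [Nh]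
  have hμ : ∑ v, (dg v : ℝ) * Real.log ((dg v : ℝ) - 1) = Nh dg * muD dg := by
    unfold muD
    field_simp
  have h1 : ∑ v, (dg v : ℝ) * (Real.log ((dg v : ℝ) - 1) - muD dg) ^ 2 ≤
      ∑ v, (Real.log (DeltaD dg) * ((dg v : ℝ) * Real.log ((dg v : ℝ) - 1))
        - 2 * muD dg * ((dg v : ℝ) * Real.log ((dg v : ℝ) - 1)) + muD dg ^ 2 * dg v) := by
    refine sum_le_sum fun v _ => ?_
    obtain ⟨ha, hb, -⟩ := log_degree_bounds hmin v
    have h2 := mul_le_mul_of_nonneg_left hb (by positivity :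
      0 ≤ (dg v : ℝ) * Real.log ((dg v : ℝ) - 1))
    nlinarith
  have h3 : ∑ v, (Real.log (DeltaD dg) * ((dg v : ℝ) * Real.log ((dg v : ℝ) - 1))
        - 2 * muD dg * ((dg v : ℝ) * Real.log ((dg v : ℝ) - 1)) + muD dg ^ 2 * dg v)
        = Nh dg * (Real.log (DeltaD dg) * muD dg - muD dg ^ 2) := by
    rw [sum_add_distrib, sum_sub_distrib, ← mul_sum, ← mul_sum, ← mul_sum, hμ, ← hs]
    ring
  unfold sigsq
  rw [inv_mul_eq_div, div_le_iff₀ hN']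
  nlinarith [mul_nonneg hN'.le (sq_nonneg (muD dg))]

lemma muD_mul_wstar_le {k : ℕ} {dg : Fin k → ℕ} (hmin : ∀ v, 3 ≤ dg v) (hN : 0 < Nh dg) :
    muD dg * wstar dg ≤ Real.sqrt (Real.log (DeltaD dg) * Real.log (Nh dg)) := by
  have hμ := half_le_muD hmin hN
  have hμ0 : 0 < muD dg := by linarith
  have hL : 0 ≤ Real.log (Nh dg) := Real.log_natCast_nonneg _
  refine Real.le_sqrt_of_sq_le ?_
  have h0 : 0 ≤ sigsq dg * Real.log (Nh dg) / muD dg ^ 3 :=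
    div_nonneg (mul_nonneg (sigsq_nonneg dg) hL) (by positivity)
  rw [mul_pow, wstar, Real.sq_sqrt h0]
  have : muD dg ^ 2 * (sigsq dg * Real.log (Nh dg) / muD dg ^ 3)
      = sigsq dg / muD dg * Real.log (Nh dg) := by
    field_simp
  rw [this]
  refine mul_le_mul_of_nonneg_right ?_ hL
  rw [div_le_iff₀ hμ0]
  exact sigsq_le hmin hN

lemma sum_degree_rpow_le {k : ℕ} {dg : Fin k → ℕ} (hmin : ∀ v, 3 ≤ dg v) (hN : 0 < Nh dg)
    {p : ℝ} (hp : 0 ≤ p) (hpD : p * Real.log (DeltaD dg) ≤ 1 / 10) :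
    ∑ u : HE k dg, ((dg u.1 : ℝ) - 1) ^ p ≤ (1 + 1.1 * (p * muD dg)) * Nh dg := by
  have hN' : (0 : ℝ) < Nh dg := by exact_mod_cast hN
  rw [sum_halfEdges dg (fun v => ((dg v : ℝ) - 1) ^ p)]
  have hs : (Nh dg : ℝ) = ∑ v, (dg v : ℝ) := by simp [Nh]
  have hμ : ∑ v, (dg v : ℝ) * Real.log ((dg v : ℝ) - 1) = Nh dg * muD dg := by
    unfold muD
    field_simp
  have h1 : ∑ v, (dg v : ℝ) * ((dg v : ℝ) - 1) ^ p ≤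
      ∑ v, ((dg v : ℝ) + 1.1 * p * ((dg v : ℝ) * Real.log ((dg v : ℝ) - 1))) := by
    refine sum_le_sum fun v _ => ?_
    obtain ⟨ha, hb, -⟩ := log_degree_bounds hmin v
    have h3 : (3 : ℝ) ≤ dg v := by exact_mod_cast hmin v
    rw [Real.rpow_def_of_pos (by linarith)]
    set m := Real.log ((dg v : ℝ) - 1) * p with hm
    have hm0 : 0 ≤ m := mul_nonneg (by linarith) hp
    have hm1 : m ≤ 1 / 10 := by
      refine le_trans ?_ hpD
      rw [hm, mul_comm]
      exact mul_le_mul_of_nonneg_left hb hp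
    have := (abs_le.1 (Real.abs_exp_sub_one_sub_id_le (x := m)
      (by rw [abs_of_nonneg hm0]; linarith))).2
    have h4 : Real.exp m ≤ 1 + 1.1 * m := by nlinarith
    have h5 := mul_le_mul_of_nonneg_left h4 (by positivity : (0 : ℝ) ≤ dg v)
    rw [hm] at h5 ⊢
    linarith
  refine h1.trans_eq ?_
  rw [sum_add_distrib, ← mul_sum, hμ, ← hs]
  ring

lemma rpow_mul_pow_le_exp {L D p μ B κ : ℝ} {T : ℕ} (hL : 1 ≤ L) (hD : 0 < D)
    (hp : p = 1 / (10 * D)) (hκ : κ = 1 / L) (hB : B ≤ L / 50) (hμ : 1 / 2 ≤ μ)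
    (hTμ : T * μ ≤ (L + B) / 2) (hDL : D + 2 * Real.log L ≤ L / 200) :
    (Real.exp (-(2 / 3) * L) * Real.exp D / (L ^ 2)⁻¹) ^ p *
      ((1 + κ) * (1 + 1.1 * (p * μ))) ^ T ≤ Real.exp (2 - L / (100 * D)) := by
  have hL0 : 0 < L := by linarith
  have hp0 : 0 < p := by rw [hp]; positivity
  have hκ0 : 0 < κ := by rw [hκ]; positivity
  have hA : (1 + κ) * (1 + 1.1 * (p * μ)) ≤ Real.exp (κ + 1.1 * (p * μ)) := by
    rw [Real.exp_add]
    have h1 := Real.add_one_le_exp κ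
    have h2 := Real.add_one_le_exp (1.1 * (p * μ))
    have : 0 ≤ p * μ := mul_nonneg hp0.le (by linarith)
    refine mul_le_mul ?_ ?_ ?_ (Real.exp_pos _).le <;> linarith
  have hAT : ((1 + κ) * (1 + 1.1 * (p * μ))) ^ T ≤ Real.exp (T * (κ + 1.1 * (p * μ))) := by
    rw [Real.exp_nat_mul]
    have : 0 ≤ p * μ := mul_nonneg hp0.le (by linarith)
    exact pow_le_pow_left₀ (by positivity) hA T
  have hbase : Real.exp (-(2 / 3) * L) * Real.exp D / (L ^ 2)⁻¹
      = Real.exp (-(2 / 3) * L + D + 2 * Real.log L) := by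
    rw [Real.exp_add, Real.exp_add, div_inv_eq_mul, two_mul (Real.log L), Real.exp_add,
      Real.exp_log hL0]
    ring
  rw [hbase, ← Real.exp_mul]
  refine (mul_le_mul_of_nonneg_left hAT (Real.exp_pos _).le).trans ?_
  rw [← Real.exp_add, Real.exp_le_exp]
  have hT : (T : ℝ) ≤ 2 * L := by nlinarith [(Nat.cast_nonneg T : (0 : ℝ) ≤ T)]
  have e1 : T * κ ≤ 2 := by
    rw [hκ, mul_one_div, div_le_iff₀ hL0]
    exact hT
  have e2 : L / (100 * D) = p * (L / 10) := by
    rw [hp]; field_simp; norm_num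
  rw [e2]
  have e3 : -(2 / 3) * L + D + 2 * Real.log L + 1.1 * (T * μ) ≤ - (L / 10) := by linarith
  nlinarith [mul_le_mul_of_nonneg_left e3 hp0.le]

lemma sq_mul_prP_small_weights_le {k : ℕ} {dg : Fin k → ℕ} {ε B : ℝ} {t : ℕ} (hε : 0 < ε)
    (hmin : ∀ v, 3 ≤ dg v) (hB : 0 ≤ B) (ht : (t : ℝ) ≤ tstar dg + B * wstar dg)
    (hL : 1 ≤ Real.log (Nh dg))
    (hDB : B * Real.sqrt (Real.log (DeltaD dg) * Real.log (Nh dg)) ≤ Real.log (Nh dg) / 50)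
    (hDL : Real.log (DeltaD dg) + 2 * Real.log (Real.log (Nh dg)) ≤ Real.log (Nh dg) / 200)
    (hδ : Real.exp (2 - Real.log (Nh dg) / (100 * Real.log (DeltaD dg))) ≤ ε / 8)
    (hlη : 4 / ε / Real.log (Nh dg) ≤ 1 / 10)
    (hwη : wminD dg ≤ (Real.log (Nh dg) ^ 2)⁻¹)
    (hNκ : (Nh dg : ℝ) ≤ (1 + 1 / Real.log (Nh dg)) *
      (Nh dg - 8 * Real.log (Nh dg) * (Nh dg : ℝ) ^ ((2 : ℝ) / 3) - 1))
    (x y : HE k dg) :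
    (Nh dg : ℝ) ^ 2 * prP dg (fun π =>
      ε < ∑ z ∈ (expFinal dg π (t / 2) (wminD dg) x y).F,
        if (expFinal dg π (t / 2) (wminD dg) x y).wt z < wminD dg
        then (expFinal dg π (t / 2) (wminD dg) x y).wt z else 0)
      ≤ Real.exp (128 / ε ^ 2 - Real.log (Nh dg)) := by
  have hN : 0 < Nh dg := card_halfEdges dg ▸ Fintype.card_pos_iff.2 ⟨x⟩
  have hN' : (0 : ℝ) < Nh dg := by exact_mod_cast hN
  set L := Real.log (Nh dg) with hLdef
  set D := Real.log (DeltaD dg) with hDdef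
  set μ := muD dg with hμdef
  set wm := wminD dg with hwm
  have hL0 : 0 < L := by linarith
  have hμ : 1 / 2 ≤ μ := half_le_muD hmin hN
  obtain ⟨hd1, hd2, hd3⟩ := log_degree_bounds hmin x.1
  have hD0 : 0 < D := by linarith
  have hΔ0 : (0 : ℝ) < DeltaD dg := by
    have : (3 : ℝ) ≤ dg x.1 := by exact_mod_cast hmin x.1
    linarith
  have hwm0 : 0 < wm := Real.rpow_pos_of_pos hN' _
  have hwmL : wm = Real.exp (-(2 / 3) * L) := by
    rw [hwm, wminD, Real.rpow_def_of_pos hN']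
    congr 1
    ring
  have hwm_inv : wm⁻¹ = (Nh dg : ℝ) ^ ((2 : ℝ) / 3) := by
    rw [hwm, wminD, ← Real.rpow_neg hN'.le]
    norm_num
  have hT2 : ((t / 2 : ℕ) : ℝ) ≤ t / 2 := Nat.cast_div_le
  have hTμ : ((t / 2 : ℕ) : ℝ) * μ ≤ (L + B * Real.sqrt (D * L)) / 2 := by
    have h1 : tstar dg * μ = L := by
      rw [tstar, ← hμdef, ← hLdef]; field_simp
    have h2 := mul_le_mul_of_nonneg_left (muD_mul_wstar_le hmin hN) hB
    have h3 := mul_le_mul_of_nonneg_right (hT2.trans (by linarith :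
      (t : ℝ) / 2 ≤ (tstar dg + B * wstar dg) / 2)) (by linarith : 0 ≤ μ)
    refine h3.trans ?_
    linarith
  have hT : ((t / 2 : ℕ) : ℝ) ≤ 2 * L := by
    nlinarith [(Nat.cast_nonneg (t / 2) : (0 : ℝ) ≤ ((t / 2 : ℕ) : ℝ))]
  set p := 1 / (10 * D) with hp
  have hp0 : 0 < p := by positivity
  have hpμ : 0 ≤ p * μ := mul_nonneg hp0.le (by linarith)
  have hκ0 : 0 < 1 / L := by positivity
  have hη1 : (L ^ 2)⁻¹ ≤ 1 := inv_le_one_of_one_le₀ (one_le_pow₀ hL)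
  have hpow := (rpow_mul_pow_le_exp hL hD0 hp rfl hDB hμ hTμ hDL).trans hδ
  rw [← hwmL, hDdef, Real.exp_log hΔ0] at hpow
  have key := prP_small_weights_le (ε := ε) (l := 4 / ε * L) (by positivity) hwη hη1 hwm0
    (by nlinarith : 1 ≤ (1 + 1 / L) * (1 + 1.1 * (p * μ))) hp0.le hκ0.le
    (by positivity : 0 ≤ ε / 8) hpow
    (by refine le_of_eq_of_le ?_ hlη; field_simp) hmin
    (fun v => (log_degree_bounds hmin v).2.2)
    (by
      have := sum_degree_rpow_le hmin hN hp0.le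
        (by rw [hp, ← hDdef]; apply le_of_eq; field_simp)
      have := mul_le_mul_of_nonneg_left this (by positivity : 0 ≤ 1 + 1 / L)
      linarith)
    (by
      refine hNκ.trans (mul_le_mul_of_nonneg_left ?_ (by positivity))
      rw [div_eq_mul_inv (4 * ((t / 2 : ℕ) : ℝ)) wm, hwm_inv]
      have := mul_le_mul_of_nonneg_right hT
        (Real.rpow_nonneg hN'.le ((2 : ℝ) / 3))
      linarith) x y
  have hN2 : (Nh dg : ℝ) ^ 2 = Real.exp (2 * L) := by
    rw [two_mul, Real.exp_add, hLdef, Real.exp_log hN', sq]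
  rw [hN2]
  refine (mul_le_mul_of_nonneg_left key (Real.exp_pos _).le).trans ?_
  rw [← Real.exp_add, Real.exp_le_exp]
  apply le_of_eq
  field_simp
  ring

lemma eventually_log_le_rpow :
    ∀ᶠ X : ℝ in atTop, Real.log X ≤ 1 / 5 * X ^ ((1 : ℝ) / 6) := by
  filter_upwards [(isLittleO_log_rpow_atTop (by norm_num : (0 : ℝ) < 1 / 6)).bound
    (by norm_num : (0 : ℝ) < 1 / 5), eventually_ge_atTop 1] with X hX hX1
  rw [Real.norm_of_nonneg (Real.log_nonneg hX1),
    Real.norm_of_nonneg (Real.rpow_nonneg (by linarith) _)] at hX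
  exact hX

lemma rpow_le_inv_log_sq {X : ℝ} (hX : 1 ≤ X) (hL : 1 ≤ Real.log X)
    (h : Real.log X ≤ 1 / 5 * X ^ ((1 : ℝ) / 6)) :
    X ^ (-(2 : ℝ) / 3) ≤ (Real.log X ^ 2)⁻¹ := by
  have hX0 : 0 < X := by linarith
  rw [show -(2 : ℝ) / 3 = -(2 / 3) by ring, Real.rpow_neg hX0.le]
  refine inv_anti₀ (by positivity) ?_
  have h1 : X ^ ((2 : ℝ) / 3) = (X ^ ((1 : ℝ) / 6)) ^ 4 := by
    rw [← Real.rpow_natCast, ← Real.rpow_mul hX0.le]; norm_num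
  rw [h1]
  have h2 : 1 ≤ X ^ ((1 : ℝ) / 6) := Real.one_le_rpow hX (by norm_num)
  calc Real.log X ^ 2 ≤ (X ^ ((1 : ℝ) / 6)) ^ 2 :=
        pow_le_pow_left₀ (by linarith) (by linarith) 2
    _ ≤ _ := pow_le_pow_right₀ h2 (by norm_num)

lemma le_one_add_inv_log_mul {X : ℝ} (hX : 1 ≤ X) (hL : 1 ≤ Real.log X)
    (h : Real.log X ≤ 1 / 5 * X ^ ((1 : ℝ) / 6)) :
    X ≤ (1 + 1 / Real.log X) * (X - 8 * Real.log X * X ^ ((2 : ℝ) / 3) - 1) := by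
  have hX0 : 0 < X := by linarith
  set L := Real.log X
  set r := X ^ ((1 : ℝ) / 6) with hr
  have hL0 : 0 < L := by linarith
  have h1 : X ^ ((2 : ℝ) / 3) = r ^ 4 := by
    rw [hr, ← Real.rpow_natCast, ← Real.rpow_mul hX0.le]; norm_num
  have h2 : X = r ^ 6 := by
    rw [hr, ← Real.rpow_natCast, ← Real.rpow_mul hX0.le]; norm_num
  rw [h1]
  have hr1 : 1 ≤ r := Real.one_le_rpow hX (by norm_num)
  have hr4 : 1 ≤ r ^ 4 := one_le_pow₀ hr1
  have hLr : L ^ 2 ≤ r ^ 2 / 25 := by nlinarith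
  have h3 : 18 * L ^ 2 * r ^ 4 ≤ X := by
    have := mul_le_mul_of_nonneg_right hLr (by positivity : 0 ≤ r ^ 4)
    have e : r ^ 2 / 25 * r ^ 4 = r ^ 6 / 25 := by ring
    rw [e] at this
    have : 0 < r ^ 6 := by positivity
    linarith
  have hb : 8 * L * r ^ 4 + 1 ≤ 9 * L * r ^ 4 := by nlinarith
  have e1 : (1 + 1 / L) * (X - 8 * L * r ^ 4 - 1)
      = X + (X - (L + 1) * (8 * L * r ^ 4 + 1)) / L := by
    field_simp
    ring
  rw [e1]
  have : 0 ≤ (X - (L + 1) * (8 * L * r ^ 4 + 1)) / L := by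
    refine div_nonneg ?_ hL0.le
    have := mul_le_mul (by linarith : L + 1 ≤ 2 * L) hb (by positivity) (by positivity)
    nlinarith
  linarith

/-- For every `ε > 0`, the probability that
`Σ_{z ∈ F} w(z) 1{w(z) < w_min} > ε` is `o(1/N²)`, the sum running over the
half-edges of the forest produced by the exposure process, with `w_min = N^{-2/3}`. -/
theorem small_weights_lemma
    (k : ℕ → ℕ) (dg : ∀ n, Fin (k n) → ℕ)
    (hN : Tendsto (fun n => (Nh (dg n) : ℝ)) atTop atTop)
    (heven : ∀ n, Even (Nh (dg n)))
    (hmin : ∀ n v, 3 ≤ dg n v)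
    (hΔ : Tendsto (fun n => Real.log (DeltaD (dg n)) / Real.log (Nh (dg n)))
      atTop (nhds 0))
    (h1 : Tendsto (fun n =>
        sigsq (dg n) / muD (dg n) ^ 3 * Real.log (Nh (dg n)) /
          Real.log (Real.log (Nh (dg n))) ^ 2) atTop atTop)
    (h2 : Tendsto (fun n =>
        Real.sqrt (sigsq (dg n)) ^ 3 / (rhoD (dg n) * Real.sqrt (muD (dg n))) *
          Real.sqrt (Real.log (Nh (dg n)))) atTop atTop)
    (x y : ∀ n, HE (k n) (dg n)) (hxy : ∀ n, x n ≠ y n)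
    (lam : ℝ) (t : ℕ → ℕ)
    (ht : Tendsto (fun n => ((t n : ℝ) - tstar (dg n) - lam * wstar (dg n)) / wstar (dg n))
      atTop (nhds 0))
    :
    ∀ ε > (0 : ℝ), Tendsto (fun n =>
      (Nh (dg n) : ℝ) ^ 2 * prP (dg n) (fun π =>
        ε < ∑ z ∈ (expFinal (dg n) π (t n / 2) (wminD (dg n)) (x n) (y n)).F,
          if (expFinal (dg n) π (t n / 2) (wminD (dg n)) (x n) (y n)).wt z < wminD (dg n)
          then (expFinal (dg n) π (t n / 2) (wminD (dg n)) (x n) (y n)).wt z else 0))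
      atTop (nhds 0) := by
  intro ε hε
  have hL : Tendsto (fun n => Real.log (Nh (dg n))) atTop atTop :=
    Real.tendsto_log_atTop.comp hN
  set B := |lam| + 1 with hBdef
  have hB : 0 < B := by positivity
  have hlogL : Tendsto (fun n => Real.log (Real.log (Nh (dg n))) / Real.log (Nh (dg n)))
      atTop (nhds 0) :=
    (Real.isLittleO_log_id_atTop.tendsto_div_nhds_zero).comp hL
  have hδ : ∀ᶠ n in atTop,
      Real.exp (2 - Real.log (Nh (dg n)) / (100 * Real.log (DeltaD (dg n)))) ≤ ε / 8 := by
    set c := max 1 (2 - Real.log (ε / 8)) with hc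
    have hc0 : 0 < c := by positivity
    filter_upwards [hΔ.eventually (gt_mem_nhds (by positivity : 0 < 1 / (100 * c))),
      hL.eventually_ge_atTop 1] with n h hL1
    obtain ⟨hd1, hd2, -⟩ := log_degree_bounds (hmin n) (x n).1
    rw [← Real.le_log_iff_exp_le (by positivity)]
    have hD : 0 < Real.log (DeltaD (dg n)) := by linarith
    have h2 : c ≤ Real.log (Nh (dg n)) / (100 * Real.log (DeltaD (dg n))) := by
      rw [le_div_iff₀ (by positivity)]
      rw [div_lt_div_iff₀ (by linarith) (by positivity)] at h
      linarith
    linarith [le_max_right 1 (2 - Real.log (ε / 8))]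
  refine squeeze_zero' (g := fun n => Real.exp (128 / ε ^ 2 - Real.log (Nh (dg n)))) ?_ ?_ ?_
  · refine Eventually.of_forall fun n => ?_
    unfold prP
    positivity
  · filter_upwards [hL.eventually_ge_atTop 1, hL.eventually_ge_atTop (40 / ε), hδ,
      hN.eventually eventually_log_le_rpow, hN.eventually_ge_atTop 1,
      h1.eventually_gt_atTop 0, ht.eventually (gt_mem_nhds zero_lt_one),
      hlogL.eventually (gt_mem_nhds (by norm_num : (0 : ℝ) < 1 / 800)),
      hΔ.eventually (gt_mem_nhds (by norm_num : (0 : ℝ) < 1 / 400)),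
      hΔ.eventually (gt_mem_nhds (by positivity : 0 < (1 / (50 * B)) ^ 2))]
      with n hL1 hLε hδn hlog hN1 hσ htn hll hD1 hD2
    have hL0 : 0 < Real.log (Nh (dg n)) := by linarith
    have hN0 : 0 < Nh (dg n) := by exact_mod_cast (by linarith : (0 : ℝ) < Nh (dg n))
    have hμ := half_le_muD (hmin n) hN0
    rw [div_lt_iff₀ hL0] at hll hD1 hD2
    refine sq_mul_prP_small_weights_le (B := B) hε (hmin n) hB.le ?_ hL1 ?_ ?_ hδn ?_
      (rpow_le_inv_log_sq hN1 hL1 hlog) (le_one_add_inv_log_mul hN1 hL1 hlog) _ _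
    · have hσ0 : 0 < sigsq (dg n) := by
        refine lt_of_le_of_ne (sigsq_nonneg _) fun h => ?_
        rw [← h] at hσ
        simp at hσ
      have hw : 0 < wstar (dg n) :=
        Real.sqrt_pos.2 (div_pos (mul_pos hσ0 hL0) (pow_pos (by linarith) 3))
      rw [div_lt_iff₀ hw] at htn
      have := mul_le_mul_of_nonneg_right (le_abs_self lam) hw.le
      rw [hBdef]
      linarith
    · rw [mul_comm, ← le_div_iff₀ hB]
      refine Real.sqrt_le_iff.2 ⟨by positivity, ?_⟩
      calc _ ≤ (1 / (50 * B)) ^ 2 * Real.log (Nh (dg n)) * Real.log (Nh (dg n)) := by gcongr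
        _ = _ := by field_simp
    · linarith
    · rw [div_le_iff₀ hL0]
      have : 4 / ε = 40 / ε / 10 := by ring
      linarith
  · exact Real.tendsto_exp_atBot.comp (tendsto_atBot_add_const_left _ _
      (tendsto_neg_atTop_atBot.comp hL))

end
end

section
/- Concentration of weighted sums along a uniform random pairing: let I be a finite set of even cardinality, {w_{i,j}}_{(i,j)∈I×I} an array of non-negative weights, and π a uniformly random pairing (fixed-point-free involution) of I. Set m := (1/(|I|−1)) Σ_{i∈I} Σ_{j≠i} w_{i,j} and θ := max_{i≠j} (w_{i,j} + w_{j,i}). Then for all a > 0, P(Σ_{i∈I} w_{i,π(i)} ≤ m − a) ≤ exp(−a²/(4θm)). -/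
open Classical Finset

noncomputable section

/-- The finite set of all pairings (fixed-point-free involutions) of `ι`. -/
def PairingsI (ι : Type) [Fintype ι] [DecidableEq ι] : Finset (Equiv.Perm ι) :=
  univ.filter fun π => (∀ x, π (π x) = x) ∧ ∀ x, π x ≠ x

lemma mem_PairingsI {ι : Type} [Fintype ι] [DecidableEq ι] {π : Equiv.Perm ι} :
    π ∈ PairingsI ι ↔ (∀ x, π (π x) = x) ∧ ∀ x, π x ≠ x := by
  simp [PairingsI]

/-- Conjugating a pairing by a transposition gives a pairing. -/
lemma swap_conj_mem_PairingsI {ι : Type} [Fintype ι] [DecidableEq ι] {π : Equiv.Perm ι}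
    (hπ : π ∈ PairingsI ι) (j k : ι) :
    Equiv.swap j k * π * Equiv.swap j k ∈ PairingsI ι := by
  rw [mem_PairingsI] at hπ ⊢
  obtain ⟨h1, h2⟩ := hπ
  refine ⟨fun x => by simp [h1], fun x hx => h2 (Equiv.swap j k x) ?_⟩
  apply (Equiv.swap j k).injective
  simpa using hx

/-- Switching the partner of `i` from `k` to `j` increases the weight of a pairing by at most the
weights of the two new pairs. -/
lemma sum_weight_swap_conj_le {ι : Type} [Fintype ι] [DecidableEq ι]
    {w : ι → ι → ℝ} (hw : ∀ i j, 0 ≤ w i j) {θ : ℝ}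
    (hθ : ∀ i j, i ≠ j → w i j + w j i ≤ θ) (hθ0 : 0 < θ) {π : Equiv.Perm ι}
    (hπ : π ∈ PairingsI ι) {i j k : ι} (hij : i ≠ j) (hik : π i = k) :
    ∑ x, w x ((Equiv.swap j k * π * Equiv.swap j k) x) ≤ ∑ x, w x (π x) + 2 * θ := by
  rw [mem_PairingsI] at hπ
  obtain ⟨h1, h2⟩ := hπ
  by_cases hjk : j = k
  · subst hjk
    simp only [Equiv.swap_self, Equiv.Perm.coe_mul, Function.comp_apply, Equiv.refl_apply]
    linarith
  have hki : π k = i := by rw [← hik, h1]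
  have hik' : i ≠ k := fun h => h2 i (hik.trans h.symm)
  set l := π j with hl
  have hlj : π l = j := by rw [hl, h1]
  have hlk : l ≠ k := fun h => hij (by rw [← hki, ← h, hlj])
  have hlj' : l ≠ j := h2 j
  have hli : l ≠ i := fun h => hjk (by rw [← hlj, h, hik])
  have hreindex : ∑ x, w x ((Equiv.swap j k * π * Equiv.swap j k) x)
      = ∑ y, w (Equiv.swap j k y) (Equiv.swap j k (π y)) := by
    rw [← Equiv.sum_comp (Equiv.swap j k)]
    simp
  rw [hreindex]
  have hpoint : ∀ y ∈ (univ : Finset ι), w (Equiv.swap j k y) (Equiv.swap j k (π y)) ≤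
      w y (π y) + ((if y = i then w i j else 0) + (if y = k then w j i else 0)
        + (if y = j then w k l else 0) + (if y = l then w l k else 0)) := by
    intro y _
    have hy := hw y (π y)
    by_cases hyi : y = i
    · subst hyi
      simp [hik, hij, hik', hli.symm, Equiv.swap_apply_of_ne_of_ne, hw]
    by_cases hyk : y = k
    · subst hyk
      simp [hki, hij, hik', hik'.symm, hlk.symm, Ne.symm hjk, Equiv.swap_apply_of_ne_of_ne, hw]
    by_cases hyj : y = j
    · subst hyj
      simp [← hl, hij.symm, hjk, hlj', hlj'.symm, hlk, Equiv.swap_apply_of_ne_of_ne, hw]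
    by_cases hyl : y = l
    · rw [hyl]
      simp [hlj, hli, hlj', hlk, Equiv.swap_apply_of_ne_of_ne, hw]
    have hπj : π y ≠ j := fun h => hyl (by rw [hl, ← h, h1])
    have hπk : π y ≠ k := fun h => hyi (by rw [← hki, ← h, h1])
    simp [hyi, hyk, hyj, hyl, hπj, hπk, Equiv.swap_apply_of_ne_of_ne]
  refine (sum_le_sum hpoint).trans ?_
  simp only [sum_add_distrib, sum_ite_eq', mem_univ, if_true]
  have := hθ i j hij
  have := hθ k l hlk.symm
  linarith

/-- The exponential sum over the pairings matching `i` with `k` is comparable to the one over the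
pairings matching `i` with `j`. -/
lemma sum_exp_filter_le {ι : Type} [Fintype ι] [DecidableEq ι]
    {w : ι → ι → ℝ} (hw : ∀ i j, 0 ≤ w i j) {θ : ℝ}
    (hθ : ∀ i j, i ≠ j → w i j + w j i ≤ θ) (hθ0 : 0 < θ) {t : ℝ} (ht : 0 ≤ t)
    {i j k : ι} (hij : i ≠ j) (hik : i ≠ k) :
    Real.exp (-(2 * θ * t)) *
        ∑ π ∈ PairingsI ι with π i = k, Real.exp (-t * ∑ x, w x (π x))
      ≤ ∑ π ∈ PairingsI ι with π i = j, Real.exp (-t * ∑ x, w x (π x)) := by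
  have hbij : ∑ π ∈ PairingsI ι with π i = k,
        Real.exp (-t * ∑ x, w x ((Equiv.swap j k * π * Equiv.swap j k) x))
      = ∑ π ∈ PairingsI ι with π i = j, Real.exp (-t * ∑ x, w x (π x)) := by
    refine sum_nbij' (fun π => Equiv.swap j k * π * Equiv.swap j k)
      (fun π => Equiv.swap j k * π * Equiv.swap j k) ?_ ?_ ?_ ?_ ?_
    · intro π hπ
      rw [mem_filter] at hπ ⊢
      exact ⟨swap_conj_mem_PairingsI hπ.1 j k,
        by simp [Equiv.swap_apply_of_ne_of_ne hij hik, hπ.2]⟩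
    · intro π hπ
      rw [mem_filter] at hπ ⊢
      exact ⟨swap_conj_mem_PairingsI hπ.1 j k,
        by simp [Equiv.swap_apply_of_ne_of_ne hij hik, hπ.2]⟩
    · intro π _
      ext x
      simp
    · intro π _
      ext x
      simp
    · intro π _
      rfl
  rw [← hbij, mul_sum]
  refine sum_le_sum fun π hπ => ?_
  rw [mem_filter] at hπ
  rw [← Real.exp_add, Real.exp_le_exp]
  have := mul_le_mul_of_nonneg_left
    (sum_weight_swap_conj_le hw hθ hθ0 hπ.1 hij hπ.2) ht
  linarith

lemma sum_exp_le_card_mul_sum_filter {ι : Type} [Fintype ι] [DecidableEq ι]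
    {w : ι → ι → ℝ} (hw : ∀ i j, 0 ≤ w i j) {θ : ℝ}
    (hθ : ∀ i j, i ≠ j → w i j + w j i ≤ θ) (hθ0 : 0 < θ) {t : ℝ} (ht : 0 ≤ t)
    {i j : ι} (hij : i ≠ j) :
    Real.exp (-(2 * θ * t)) * ∑ π ∈ PairingsI ι, Real.exp (-t * ∑ x, w x (π x))
      ≤ ((Fintype.card ι : ℝ) - 1) *
        ∑ π ∈ PairingsI ι with π i = j, Real.exp (-t * ∑ x, w x (π x)) := by
  have hmaps : ∀ π ∈ PairingsI ι, π i ∈ univ.erase i := fun π hπ => by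
    simpa using (mem_PairingsI.1 hπ).2 i
  rw [← sum_fiberwise_of_maps_to hmaps, mul_sum]
  refine (sum_le_sum fun k hk =>
    sum_exp_filter_le hw hθ hθ0 ht hij (ne_of_mem_erase hk).symm).trans ?_
  have : 1 ≤ Fintype.card ι := Fintype.card_pos_iff.2 ⟨i⟩
  rw [sum_const, card_erase_of_mem (mem_univ i), card_univ, nsmul_eq_mul, Nat.cast_sub this,
    Nat.cast_one]

/-- Size-bias inequality for the exponential sum over pairings. -/
lemma exp_mul_sum_exp_le_sum_weight_mul_exp {ι : Type} [Fintype ι] [DecidableEq ι]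
    {w : ι → ι → ℝ} (hw : ∀ i j, 0 ≤ w i j) {θ : ℝ}
    (hθ : ∀ i j, i ≠ j → w i j + w j i ≤ θ) (hθ0 : 0 < θ) {t : ℝ} (ht : 0 ≤ t)
    (hcard : 1 < Fintype.card ι) :
    (((Fintype.card ι : ℝ) - 1)⁻¹ * ∑ i, ∑ j ∈ univ.erase i, w i j) *
        (Real.exp (-(2 * θ * t)) * ∑ π ∈ PairingsI ι, Real.exp (-t * ∑ x, w x (π x)))
      ≤ ∑ π ∈ PairingsI ι, (∑ x, w x (π x)) * Real.exp (-t * ∑ x, w x (π x)) := by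
  have hpos : 0 < (Fintype.card ι : ℝ) - 1 := by
    have : (1 : ℝ) < Fintype.card ι := by exact_mod_cast hcard
    linarith
  have hexpand : ∑ π ∈ PairingsI ι, (∑ x, w x (π x)) * Real.exp (-t * ∑ x, w x (π x))
      = ∑ i, ∑ j ∈ univ.erase i, w i j *
        ∑ π ∈ PairingsI ι with π i = j, Real.exp (-t * ∑ x, w x (π x)) := by
    simp_rw [sum_mul]
    rw [sum_comm]
    refine sum_congr rfl fun i _ => ?_
    have hmaps : ∀ π ∈ PairingsI ι, π i ∈ univ.erase i := fun π hπ => by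
      simpa using (mem_PairingsI.1 hπ).2 i
    rw [← sum_fiberwise_of_maps_to hmaps]
    refine sum_congr rfl fun j _ => ?_
    rw [mul_sum]
    refine sum_congr rfl fun π hπ => ?_
    rw [(mem_filter.1 hπ).2]
  rw [hexpand, mul_assoc, inv_mul_le_iff₀ hpos, sum_mul, mul_sum univ]
  refine sum_le_sum fun i _ => ?_
  rw [sum_mul, mul_sum (univ.erase i)]
  refine sum_le_sum fun j hj => ?_
  rw [mul_left_comm ((Fintype.card ι : ℝ) - 1)]
  exact mul_le_mul_of_nonneg_left
    (sum_exp_le_card_mul_sum_filter hw hθ hθ0 ht (ne_of_mem_erase hj).symm) (hw i j)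

/-- If the Laplace transform `∑ exp (-t W)` of a finite family satisfies the size-bias inequality
with bias `c`, then it is sub-Gaussian on the lower tail. -/
lemma sum_exp_neg_le_of_size_bias {α : Type*} (s : Finset α) (W : α → ℝ) {m c : ℝ} (hm : 0 ≤ m)
    (h : ∀ t, 0 ≤ t → m * (Real.exp (-(c * t)) * ∑ x ∈ s, Real.exp (-t * W x))
      ≤ ∑ x ∈ s, W x * Real.exp (-t * W x)) {t : ℝ} (ht : 0 ≤ t) :
    ∑ x ∈ s, Real.exp (-t * W x) ≤ #s * Real.exp (-(t * m) + c / 2 * m * t ^ 2) := by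
  set F : ℝ → ℝ := fun t => ∑ x ∈ s, Real.exp (-t * W x)
  set G : ℝ → ℝ := fun t => Real.exp (t * m - c / 2 * m * t ^ 2)
  have hF : ∀ t, HasDerivAt F (-∑ x ∈ s, W x * Real.exp (-t * W x)) t := fun t => by
    rw [← sum_neg_distrib]
    refine HasDerivAt.fun_sum fun x _ => ?_
    exact (((hasDerivAt_id' t).neg.mul_const (W x)).exp).congr_deriv
      (by simp only [Pi.neg_apply]; ring)
  have hG : ∀ t, HasDerivAt G (G t * (m - c * m * t)) t := fun t => by
    refine ((((hasDerivAt_id' t).mul_const m).sub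
      ((hasDerivAt_pow 2 t).const_mul (c / 2 * m))).exp).congr_deriv ?_
    simp only [G, Pi.sub_apply, Nat.cast_ofNat, Nat.add_one_sub_one, pow_one]
    ring
  have hFG : ∀ t, HasDerivAt (fun t => F t * G t)
      (-(∑ x ∈ s, W x * Real.exp (-t * W x)) * G t + F t * (G t * (m - c * m * t))) t :=
    fun t => (hF t).mul (hG t)
  have hanti : AntitoneOn (fun t => F t * G t) (Set.Ici 0) := by
    refine antitoneOn_of_deriv_nonpos (convex_Ici 0)
      (fun t _ => (hFG t).continuousAt.continuousWithinAt)
      (fun t _ => (hFG t).differentiableAt.differentiableWithinAt) fun t htmem => ?_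
    rw [interior_Ici] at htmem
    rw [(hFG t).deriv]
    have hsb := h t (le_of_lt htmem)
    have hF0 : 0 ≤ F t := sum_nonneg fun x _ => (Real.exp_pos _).le
    have hexp : 1 - c * t ≤ Real.exp (-(c * t)) := by
      have := Real.add_one_le_exp (-(c * t))
      linarith
    have hlin : m * ((1 - c * t) * F t) ≤ ∑ x ∈ s, W x * Real.exp (-t * W x) :=
      (mul_le_mul_of_nonneg_left (mul_le_mul_of_nonneg_right hexp hF0) hm).trans hsb
    have := mul_le_mul_of_nonneg_right hlin (Real.exp_pos (t * m - c / 2 * m * t ^ 2)).le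
    linarith
  have hle := hanti (Set.mem_Ici.2 le_rfl) (Set.mem_Ici.2 ht) ht
  have hzero : F 0 * G 0 = #s := by simp [F, G]
  simp only [hzero] at hle
  have hinv : Real.exp (-(t * m) + c / 2 * m * t ^ 2) = (G t)⁻¹ := by
    rw [← Real.exp_neg]
    ring_nf
  rw [hinv, ← div_eq_mul_inv, le_div_iff₀ (Real.exp_pos _)]
  exact hle

/-- **Concentration of weighted sums along a uniform random pairing**: with
`m = (|I|-1)⁻¹ Σ_{i} Σ_{j ≠ i} w_{i,j}` and `θ ≥ max_{i ≠ j}(w_{i,j} + w_{j,i})`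
(both positive), for all `a > 0`,
`P(Σ_i w_{i, π(i)} ≤ m - a) ≤ exp(-a²/(4θm))`. -/
theorem pairing_concentration (ι : Type) [Fintype ι] [DecidableEq ι]
    (heven : Even (Fintype.card ι))
    (w : ι → ι → ℝ) (hw : ∀ i j, 0 ≤ w i j) (m θ : ℝ)
    (hm : m = ((Fintype.card ι : ℝ) - 1)⁻¹ * ∑ i, ∑ j ∈ univ.erase i, w i j)
    (hθ : ∀ i j, i ≠ j → w i j + w j i ≤ θ) (hθ0 : 0 < θ) (hm0 : 0 < m)
    (a : ℝ) (ha : 0 < a) :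
    (((PairingsI ι).filter fun π => ∑ i, w i (π i) ≤ m - a).card : ℝ) /
        ((PairingsI ι).card : ℝ)
      ≤ Real.exp (-a ^ 2 / (4 * θ * m)) := by
  have hcard : 1 < Fintype.card ι := by
    by_contra! hle
    obtain ⟨r, hr⟩ := heven
    have : IsEmpty ι := Fintype.card_eq_zero_iff.1 (by omega)
    simp [hm] at hm0
  set t : ℝ := a / (2 * θ * m) with ht_def
  have ht : 0 ≤ t := by positivity
  have hlaplace := sum_exp_neg_le_of_size_bias (PairingsI ι) (fun π => ∑ i, w i (π i))
    (c := 2 * θ) hm0.le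
    (fun t ht => hm ▸ exp_mul_sum_exp_le_sum_weight_mul_exp hw hθ hθ0 ht hcard) ht
  have hmarkov : (((PairingsI ι).filter fun π => ∑ i, w i (π i) ≤ m - a).card : ℝ) *
      Real.exp (-t * (m - a)) ≤ ∑ π ∈ PairingsI ι, Real.exp (-t * ∑ i, w i (π i)) := by
    rw [← nsmul_eq_mul, ← sum_const]
    refine (sum_le_sum fun π hπ => ?_).trans
      (sum_le_sum_of_subset_of_nonneg (filter_subset _ _) fun π _ _ => (Real.exp_pos _).le)
    rw [Real.exp_le_exp]
    have := mul_le_mul_of_nonneg_left (mem_filter.1 hπ).2 ht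
    linarith
  refine div_le_of_le_mul₀ (Nat.cast_nonneg _) (Real.exp_pos _).le ?_
  have hle := hmarkov.trans hlaplace
  rw [← le_div_iff₀ (Real.exp_pos _), mul_div_assoc, ← Real.exp_sub] at hle
  refine hle.trans_eq ?_
  rw [mul_comm]
  congr 2
  rw [ht_def]
  field_simp
  ring

end
end
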